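/- arXiv:2501.11981 — 2 statements merged into one kernel-verified Lean document; each statement's English description precedes it below -/
import Mathlib

section
/- For every Lebesgue-integrable function q : [0,c] → ℝ one has ∫_T q(y)·∂²ₓₓφ(x,y) dx dy + ∫_K q(y)·∂²ₓₓψ(x,y) dx dy = 0. -/
open MvPolynomial MeasureTheory

/-- The Adini shape-function space `𝒜 = P₃ + span{x³y, xy³}`, spanned by the
twelve monomials `1, x, y, x², xy, y², x³, x²y, xy², y³, x³y, xy³`. -/
noncomputable def AdiniSpace : Submodule ℝ (MvPolynomial (Fin 2) ℝ) :=
  Submodule.span ℝ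
    ({1, X 0, X 1, X 0 ^ 2, X 0 * X 1, X 1 ^ 2, X 0 ^ 3, X 0 ^ 2 * X 1,
      X 0 * X 1 ^ 2, X 1 ^ 3, X 0 ^ 3 * X 1, X 0 * X 1 ^ 3} :
      Set (MvPolynomial (Fin 2) ℝ))

/-- Evaluation of a polynomial in the two variables at the point `(x, y)`. -/
noncomputable def pev (x y : ℝ) (p : MvPolynomial (Fin 2) ℝ) : ℝ :=
  eval ![x, y] p

/-- Partial derivative `∂ₓ`. -/
noncomputable def dX : MvPolynomial (Fin 2) ℝ → MvPolynomial (Fin 2) ℝ :=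
  pderiv (0 : Fin 2)

/-- Partial derivative `∂_y`. -/
noncomputable def dY : MvPolynomial (Fin 2) ℝ → MvPolynomial (Fin 2) ℝ :=
  pderiv (1 : Fin 2)

/-- The Adini degree of freedom at a vertex `v` with multi-index
`β = 0 ↔ (0,0)` (point value), `β = 1 ↔ (1,0)` (`∂ₓ`), `β = 2 ↔ (0,1)` (`∂_y`). -/
noncomputable def adiniDof (β : Fin 3) (v : ℝ × ℝ) (p : MvPolynomial (Fin 2) ℝ) : ℝ :=
  if β = 0 then pev v.1 v.2 p else if β = 1 then pev v.1 v.2 (dX p) else pev v.1 v.2 (dY p)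

/-- Vertices of the reference square `[−1,1]²`:
`z₁ = (−1,−1)`, `z₂ = (1,−1)`, `z₃ = (1,1)`, `z₄ = (−1,1)`. -/
noncomputable def refVertex : Fin 4 → ℝ × ℝ := ![(-1, -1), (1, -1), (1, 1), (-1, 1)]

/-- Every element of the Adini space is a linear combination of the twelve monomials. -/
lemma exists_coeff_of_mem_adiniSpace {p : MvPolynomial (Fin 2) ℝ} (hp : p ∈ AdiniSpace) :
    ∃ k : Fin 12 → ℝ, p = C (k 0) + C (k 1) * X 0 + C (k 2) * X 1 + C (k 3) * X 0 ^ 2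
      + C (k 4) * (X 0 * X 1) + C (k 5) * X 1 ^ 2 + C (k 6) * X 0 ^ 3
      + C (k 7) * (X 0 ^ 2 * X 1) + C (k 8) * (X 0 * X 1 ^ 2) + C (k 9) * X 1 ^ 3
      + C (k 10) * (X 0 ^ 3 * X 1) + C (k 11) * (X 0 * X 1 ^ 3) := by
  simp only [AdiniSpace, Submodule.mem_span_insert, Submodule.mem_span_singleton,
    smul_eq_C_mul] at hp
  obtain ⟨k0, _, ⟨k1, _, ⟨k2, _, ⟨k3, _, ⟨k4, _, ⟨k5, _, ⟨k6, _, ⟨k7, _, ⟨k8, _, ⟨k9, _,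
    ⟨k10, _, ⟨k11, rfl⟩, rfl⟩, rfl⟩, rfl⟩, rfl⟩, rfl⟩, rfl⟩, rfl⟩, rfl⟩, rfl⟩, rfl⟩, rfl⟩ := hp
  refine ⟨![k0, k1, k2, k3, k4, k5, k6, k7, k8, k9, k10, k11], ?_⟩
  simp only [Matrix.cons_val]
  ring

/-- The Adini basis function of `∂ₓ` at the origin on the rectangle with opposite vertex `(s, c)`
is `x (x - s)² / s² * (1 - y / c)`; this is its second `x`-derivative. -/
lemma pev_dX_dX_of_adiniDof {s c : ℝ} (hs : s ≠ 0) (hc : c ≠ 0) {p : MvPolynomial (Fin 2) ℝ}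
    (hp : p ∈ AdiniSpace) (h0 : ∀ β : Fin 3, adiniDof β (0, 0) p = if β = 1 then 1 else 0)
    (hv : ∀ β : Fin 3,
      adiniDof β (s, 0) p = 0 ∧ adiniDof β (s, c) p = 0 ∧ adiniDof β (0, c) p = 0) (x y : ℝ) :
    pev x y (dX (dX p)) = (6 * x / s ^ 2 - 4 / s) * (1 - y / c) := by
  obtain ⟨k, rfl⟩ := exists_coeff_of_mem_adiniSpace hp
  have e0 := h0 0
  have e1 := h0 1
  have e2 := h0 2
  obtain ⟨a0, b0, d0⟩ := hv 0
  obtain ⟨a1, b1, d1⟩ := hv 1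
  obtain ⟨a2, b2, d2⟩ := hv 2
  have pderiv_two : pderiv (R := ℝ) (0 : Fin 2) 2 = 0 := (pderiv 0).map_natCast 2
  have pderiv_three : pderiv (R := ℝ) (0 : Fin 2) 3 = 0 := (pderiv 0).map_natCast 3
  simp [adiniDof, pev, dX, dY, pderiv_X, pderiv_two, pderiv_three]
    at e0 e1 e2 a0 b0 d0 a1 b1 d1 a2 b2 d2 ⊢
  simp only [e0, e1, e2] at a0 b0 d0 a1 b1 d1 a2 b2 d2
  have k3 : k 3 = -2 / s := by
    field_simp
    apply mul_left_cancel₀ hs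
    linear_combination 3 * a0 - s * a1
  have k6 : k 6 = 1 / s ^ 2 := by
    field_simp
    apply mul_left_cancel₀ hs
    linear_combination s * a1 - 2 * a0
  have k5 : k 5 = 0 := by
    apply mul_left_cancel₀ (pow_ne_zero 2 hc)
    linear_combination 3 * d0 - c * d2
  have k9 : k 9 = 0 := by
    apply mul_left_cancel₀ (pow_ne_zero 3 hc)
    linear_combination c * d2 - 2 * d0
  simp only [k5, k9] at b0 b2
  have k8 : k 8 = 0 := by
    apply mul_left_cancel₀ (mul_ne_zero hs (pow_ne_zero 2 hc))
    linear_combination 3 * b0 - 3 * a0 - c * b2 - 2 * c * a2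
  have k11 : k 11 = 0 := by
    apply mul_left_cancel₀ (mul_ne_zero hs (pow_ne_zero 3 hc))
    linear_combination c * b2 + c * a2 - 2 * b0 + 2 * a0
  simp only [k8, k11] at b1 d1
  have k4 : k 4 = -1 / c := by
    field_simp
    linear_combination d1
  have k7 : k 7 = 2 / (s * c) := by
    field_simp
    apply mul_left_cancel₀ hs
    linear_combination s * (a1 - b1) + 3 * c * a2 - 2 * s * d1
  have k10 : k 10 = -1 / (s ^ 2 * c) := by
    field_simp
    apply mul_left_cancel₀ hs
    linear_combination s * (b1 - a1) - 2 * c * a2 + s * d1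
  rw [k3, k6, k7, k10]
  field_simp
  ring

/-- **Lemma l:varphiz10 (c).** For the Adini basis functions `φ`, `ψ` of the
degree of freedom `∂ₓ` at the shared vertex `z = (0,0)` on `T = [0,a] × [0,c]`
and `K = [−b,0] × [0,c]` and any integrable `q = q(y)`,
`∫_{T∪K} q(y) ∂²ₓₓ = 0`. -/
theorem adini_dx_dxx_orth (a b c : ℝ) (ha : 0 < a) (hb : 0 < b) (hc : 0 < c)
    (φ ψ : MvPolynomial (Fin 2) ℝ) (hφA : φ ∈ AdiniSpace) (hψA : ψ ∈ AdiniSpace)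
    (hφ0 : ∀ β : Fin 3, adiniDof β (0, 0) φ = if β = 1 then 1 else 0)
    (hφv : ∀ β : Fin 3,
      adiniDof β (a, 0) φ = 0 ∧ adiniDof β (a, c) φ = 0 ∧ adiniDof β (0, c) φ = 0)
    (hψ0 : ∀ β : Fin 3, adiniDof β (0, 0) ψ = if β = 1 then 1 else 0)
    (hψv : ∀ β : Fin 3,
      adiniDof β (-b, 0) ψ = 0 ∧ adiniDof β (-b, c) ψ = 0 ∧ adiniDof β (0, c) ψ = 0)
    (q : ℝ → ℝ) (hq : IntegrableOn q (Set.Icc 0 c)) :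
    (∫ x in (0 : ℝ)..a, ∫ y in (0 : ℝ)..c, q y * pev x y (dX (dX φ)))
      + (∫ x in (-b : ℝ)..0, ∫ y in (0 : ℝ)..c, q y * pev x y (dX (dX ψ))) = 0 := by
  have hT := pev_dX_dX_of_adiniDof ha.ne' hc.ne' hφA hφ0 hφv
  have hK := pev_dX_dX_of_adiniDof (neg_ne_zero.mpr hb.ne') hc.ne' hψA hψ0 hψv
  have inner (m : ℝ) : ∫ y in (0 : ℝ)..c, q y * (m * (1 - y / c))
      = m * ∫ y in (0 : ℝ)..c, q y * (1 - y / c) := by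
    rw [← intervalIntegral.integral_const_mul]
    congr 1 with y
    ring
  have outer (s u v : ℝ) : ∫ x in u..v, (6 * x / s ^ 2 - 4 / s)
      = 3 * (v ^ 2 - u ^ 2) / s ^ 2 - 4 * (v - u) / s := by
    rw [intervalIntegral.integral_sub (by apply Continuous.intervalIntegrable; fun_prop) (by simp)]
    rw [intervalIntegral.integral_div, intervalIntegral.integral_const_mul (6 : ℝ) (fun x => x),
      integral_id, intervalIntegral.integral_const, smul_eq_mul]
    ring
  simp only [hT, hK, inner, intervalIntegral.integral_mul_const, outer]
  field_simp
  ring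
end

section
/- Fix a multi-index α ∈ {(0,0),(1,0),(0,1)}. For i = 1,…,4 let φᵢ ∈ 𝒜 satisfy ∂^βφᵢ(0,0) = δ_{αβ} for all multi-indices β with |β| ≤ 1, while φᵢ, ∂ₓφᵢ, ∂_yφᵢ vanish at the three vertices of Tᵢ other than the origin. Then for every affine polynomial p (total degree at most 1) and every choice of second derivative ∂²_{jk} ∈ {∂²ₓₓ, ∂²ₓᵧ, ∂²ᵧᵧ}: Σ_{i=1}^{4} ∫_{Tᵢ} p(x,y)·∂²_{jk}φᵢ(x,y) dx dy = 0. -/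
open MvPolynomial MeasureTheory

theorem integral_cubic (l k₀ k₁ k₂ k₃ : ℝ) :
    ∫ y in (0 : ℝ)..l, (k₀ + k₁ * y + k₂ * y ^ 2 + k₃ * y ^ 3)
      = k₀ * l + k₁ * l ^ 2 / 2 + k₂ * l ^ 3 / 3 + k₃ * l ^ 4 / 4 := by
  have hderiv : ∀ y ∈ Set.uIcc 0 l,
      HasDerivAt (fun y : ℝ => k₀ * y + k₁ * y ^ 2 / 2 + k₂ * y ^ 3 / 3 + k₃ * y ^ 4 / 4)
        (k₀ + k₁ * y + k₂ * y ^ 2 + k₃ * y ^ 3) y := by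
    intro y _
    have h := ((((hasDerivAt_id y).const_mul k₀).add
      (((hasDerivAt_pow 2 y).const_mul k₁).div_const 2)).add
      (((hasDerivAt_pow 3 y).const_mul k₂).div_const 3)).add
      (((hasDerivAt_pow 4 y).const_mul k₃).div_const 4)
    refine h.congr_deriv ?_
    norm_num
    ring
  rw [intervalIntegral.integral_eq_sub_of_hasDerivAt hderiv
    (Continuous.intervalIntegrable (by fun_prop) _ _)]
  ring

theorem iteratedIntegral_cubic {f : ℝ → ℝ → ℝ}
    (s t k₀ k₁ k₂ k₃ k₄ k₅ k₆ k₇ k₈ k₉ : ℝ)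
    (hf : ∀ x y, f x y = k₀ + k₁ * x + k₂ * y + k₃ * x ^ 2 + k₄ * x * y + k₅ * y ^ 2
      + k₆ * x ^ 3 + k₇ * x ^ 2 * y + k₈ * x * y ^ 2 + k₉ * y ^ 3) :
    ∫ x in (0 : ℝ)..s, ∫ y in (0 : ℝ)..t, f x y
      = k₀ * s * t + k₁ * s ^ 2 * t / 2 + k₂ * s * t ^ 2 / 2 + k₃ * s ^ 3 * t / 3
        + k₄ * s ^ 2 * t ^ 2 / 4 + k₅ * s * t ^ 3 / 3 + k₆ * s ^ 4 * t / 4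
        + k₇ * s ^ 3 * t ^ 2 / 6 + k₈ * s ^ 2 * t ^ 3 / 6 + k₉ * s * t ^ 4 / 4 := by
  have hinner : ∀ x, ∫ y in (0 : ℝ)..t, f x y
      = (k₀ * t + k₂ * t ^ 2 / 2 + k₅ * t ^ 3 / 3 + k₉ * t ^ 4 / 4)
        + (k₁ * t + k₄ * t ^ 2 / 2 + k₈ * t ^ 3 / 3) * x
        + (k₃ * t + k₇ * t ^ 2 / 2) * x ^ 2 + (k₆ * t) * x ^ 3 := by
    intro x
    have hfx : ∀ y, f x y = (k₀ + k₁ * x + k₃ * x ^ 2 + k₆ * x ^ 3)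
        + (k₂ + k₄ * x + k₇ * x ^ 2) * y + (k₅ + k₈ * x) * y ^ 2 + k₉ * y ^ 3 := by
      intro y
      rw [hf]
      ring
    simp_rw [hfx, integral_cubic]
    ring
  simp_rw [hinner, integral_cubic]
  ring

theorem exists_pev_eq_affine {p : MvPolynomial (Fin 2) ℝ} (hp : p.totalDegree ≤ 1) :
    ∃ q₀ q₁ q₂ : ℝ, ∀ x y, pev x y p = q₀ + q₁ * x + q₂ * y := by
  rw [p.as_sum]
  refine Finset.sum_induction _
    (fun p => ∃ q₀ q₁ q₂ : ℝ, ∀ x y, pev x y p = q₀ + q₁ * x + q₂ * y) ?_ ?_ ?_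
  · rintro f g ⟨a₀, a₁, a₂, hf⟩ ⟨b₀, b₁, b₂, hg⟩
    refine ⟨a₀ + b₀, a₁ + b₁, a₂ + b₂, fun x y => ?_⟩
    have hadd : pev x y (f + g) = pev x y f + pev x y g := by simp [pev]
    rw [hadd, hf, hg]
    ring
  · exact ⟨0, 0, 0, fun x y => by simp [pev]⟩
  · intro m hm
    have hdeg : m 0 + m 1 ≤ 1 := by
      have h := (le_totalDegree hm).trans hp
      rwa [Finsupp.sum_fintype _ _ (fun _ => rfl), Fin.sum_univ_two] at h
    have heval : ∀ x y, pev x y (monomial m (coeff m p))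
        = coeff m p * (x ^ m 0 * y ^ m 1) := by
      intro x y
      rw [pev, eval_monomial, Finsupp.prod_fintype _ _ (fun _ => pow_zero _), Fin.prod_univ_two]
      rfl
    have hcases : m 0 = 0 ∧ m 1 = 0 ∨ m 0 = 1 ∧ m 1 = 0 ∨ m 0 = 0 ∧ m 1 = 1 := by omega
    rcases hcases with ⟨h₀, h₁⟩ | ⟨h₀, h₁⟩ | ⟨h₀, h₁⟩
    · exact ⟨coeff m p, 0, 0, fun x y => by rw [heval, h₀, h₁]; ring⟩
    · exact ⟨0, coeff m p, 0, fun x y => by rw [heval, h₀, h₁]; ring⟩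
    · exact ⟨0, 0, coeff m p, fun x y => by rw [heval, h₀, h₁]; ring⟩

/-- The element of the Adini space with coefficients `c` with respect to its twelve monomials. -/
noncomputable def adiniPoly (c : Fin 12 → ℝ) : MvPolynomial (Fin 2) ℝ :=
  C (c 0) + C (c 1) * X 0 + C (c 2) * X 1 + C (c 3) * X 0 ^ 2 + C (c 4) * (X 0 * X 1)
    + C (c 5) * X 1 ^ 2 + C (c 6) * X 0 ^ 3 + C (c 7) * (X 0 ^ 2 * X 1) + C (c 8) * (X 0 * X 1 ^ 2)
    + C (c 9) * X 1 ^ 3 + C (c 10) * (X 0 ^ 3 * X 1) + C (c 11) * (X 0 * X 1 ^ 3)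

theorem exists_eq_adiniPoly {f : MvPolynomial (Fin 2) ℝ} (hf : f ∈ AdiniSpace) :
    ∃ c, f = adiniPoly c := by
  simp only [AdiniSpace, Submodule.mem_span_insert, Submodule.mem_span_singleton] at hf
  obtain ⟨c₀, _, ⟨c₁, _, ⟨c₂, _, ⟨c₃, _, ⟨c₄, _, ⟨c₅, _, ⟨c₆, _, ⟨c₇, _, ⟨c₈, _, ⟨c₉, _,
    ⟨c₁₀, _, ⟨c₁₁, rfl⟩, rfl⟩, rfl⟩, rfl⟩, rfl⟩, rfl⟩, rfl⟩, rfl⟩, rfl⟩, rfl⟩, rfl⟩, rfl⟩ := hf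
  refine ⟨![c₀, c₁, c₂, c₃, c₄, c₅, c₆, c₇, c₈, c₉, c₁₀, c₁₁], ?_⟩
  change _ = C c₀ + C c₁ * X 0 + C c₂ * X 1 + C c₃ * X 0 ^ 2 + C c₄ * (X 0 * X 1)
    + C c₅ * X 1 ^ 2 + C c₆ * X 0 ^ 3 + C c₇ * (X 0 ^ 2 * X 1) + C c₈ * (X 0 * X 1 ^ 2)
    + C c₉ * X 1 ^ 3 + C c₁₀ * (X 0 ^ 3 * X 1) + C c₁₁ * (X 0 * X 1 ^ 3)
  simp only [smul_eq_C_mul]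
  ring

theorem pderiv_ofNat {σ R : Type*} [CommSemiring R] (i : σ) (n : ℕ) [n.AtLeastTwo] :
    pderiv i (ofNat(n) : MvPolynomial σ R) = 0 :=
  (pderiv i).map_natCast n

theorem pev_adiniPoly (c : Fin 12 → ℝ) (x y : ℝ) :
    pev x y (adiniPoly c) = c 0 + c 1 * x + c 2 * y + c 3 * x ^ 2 + c 4 * (x * y) + c 5 * y ^ 2
      + c 6 * x ^ 3 + c 7 * (x ^ 2 * y) + c 8 * (x * y ^ 2) + c 9 * y ^ 3
      + c 10 * (x ^ 3 * y) + c 11 * (x * y ^ 3) := by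
  simp [pev, adiniPoly]

theorem pev_dX_adiniPoly (c : Fin 12 → ℝ) (x y : ℝ) :
    pev x y (dX (adiniPoly c)) = c 1 + 2 * c 3 * x + c 4 * y + 3 * c 6 * x ^ 2 + 2 * c 7 * x * y
      + c 8 * y ^ 2 + 3 * c 10 * x ^ 2 * y + c 11 * y ^ 3 := by
  simp [pev, adiniPoly, dX, pderiv_X, Derivation.leibniz, Derivation.leibniz_pow]
  ring

theorem pev_dY_adiniPoly (c : Fin 12 → ℝ) (x y : ℝ) :
    pev x y (dY (adiniPoly c)) = c 2 + c 4 * x + 2 * c 5 * y + c 7 * x ^ 2 + 2 * c 8 * x * y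
      + 3 * c 9 * y ^ 2 + c 10 * x ^ 3 + 3 * c 11 * x * y ^ 2 := by
  simp [pev, adiniPoly, dY, pderiv_X, Derivation.leibniz, Derivation.leibniz_pow]
  ring

theorem pev_pderiv_zero_zero_adiniPoly (c : Fin 12 → ℝ) (x y : ℝ) :
    pev x y (pderiv 0 (pderiv 0 (adiniPoly c)))
      = 2 * c 3 + 6 * c 6 * x + 2 * c 7 * y + 6 * c 10 * x * y := by
  simp [pev, adiniPoly, pderiv_X, pderiv_ofNat, Derivation.leibniz, Derivation.leibniz_pow]
  ring

theorem pev_pderiv_zero_one_adiniPoly (c : Fin 12 → ℝ) (x y : ℝ) :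
    pev x y (pderiv 0 (pderiv 1 (adiniPoly c)))
      = c 4 + 2 * c 7 * x + 2 * c 8 * y + 3 * c 10 * x ^ 2 + 3 * c 11 * y ^ 2 := by
  simp [pev, adiniPoly, pderiv_X, pderiv_ofNat, Derivation.leibniz, Derivation.leibniz_pow]
  ring

theorem pev_pderiv_one_zero_adiniPoly (c : Fin 12 → ℝ) (x y : ℝ) :
    pev x y (pderiv 1 (pderiv 0 (adiniPoly c)))
      = c 4 + 2 * c 7 * x + 2 * c 8 * y + 3 * c 10 * x ^ 2 + 3 * c 11 * y ^ 2 := by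
  simp [pev, adiniPoly, pderiv_X, pderiv_ofNat, Derivation.leibniz, Derivation.leibniz_pow]
  ring

theorem pev_pderiv_one_one_adiniPoly (c : Fin 12 → ℝ) (x y : ℝ) :
    pev x y (pderiv 1 (pderiv 1 (adiniPoly c)))
      = 2 * c 5 + 2 * c 8 * x + 6 * c 9 * y + 6 * c 11 * x * y := by
  simp [pev, adiniPoly, pderiv_X, pderiv_ofNat, Derivation.leibniz, Derivation.leibniz_pow]
  ring

/-- The coefficients of an Adini basis function associated with the vertex at the origin of a
rectangle with signed side lengths `s` and `t`. -/
theorem adiniPoly_coeff_eq {A : Fin 3 → ℝ} {s t : ℝ} (hs : s ≠ 0) (ht : t ≠ 0) {c : Fin 12 → ℝ}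
    (h₀ : ∀ β, adiniDof β (0, 0) (adiniPoly c) = A β)
    (h : ∀ β, adiniDof β (s, 0) (adiniPoly c) = 0 ∧ adiniDof β (s, t) (adiniPoly c) = 0 ∧
      adiniDof β (0, t) (adiniPoly c) = 0) :
    c 3 = (-3 * A 0 - 2 * s * A 1) / s ^ 2 ∧
      c 4 = (-A 0 - s * A 1 - t * A 2) / (s * t) ∧
      c 5 = (-3 * A 0 - 2 * t * A 2) / t ^ 2 ∧
      c 6 = (2 * A 0 + s * A 1) / s ^ 3 ∧
      c 7 = (3 * A 0 + 2 * s * A 1) / (s ^ 2 * t) ∧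
      c 8 = (3 * A 0 + 2 * t * A 2) / (s * t ^ 2) ∧
      c 9 = (2 * A 0 + t * A 2) / t ^ 3 ∧
      c 10 = (-2 * A 0 - s * A 1) / (s ^ 3 * t) ∧
      c 11 = (-2 * A 0 - t * A 2) / (s * t ^ 3) := by
  have e₀ := h₀ 0
  have e₁ := h₀ 1
  have e₂ := h₀ 2
  obtain ⟨a₀, b₀, d₀⟩ := h 0
  obtain ⟨a₁, b₁, d₁⟩ := h 1
  obtain ⟨a₂, b₂, d₂⟩ := h 2
  simp only [adiniDof, if_true, one_ne_zero, if_false, pev_adiniPoly, pev_dX_adiniPoly,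
    pev_dY_adiniPoly, (by decide : (2 : Fin 3) ≠ 0), (by decide : (2 : Fin 3) ≠ 1)]
    at e₀ e₁ e₂ a₀ a₁ a₂ b₀ b₁ b₂ d₀ d₁ d₂
  have f₀ : c 0 = A 0 := by linarith
  have f₁ : c 1 = A 1 := by linarith
  have f₂ : c 2 = A 2 := by linarith
  rw [f₀, f₁, f₂] at a₀ b₀ d₀
  rw [f₁] at a₁ b₁ d₁
  rw [f₂] at a₂ b₂ d₂
  replace a₁ := congrArg (s * ·) a₁
  replace b₁ := congrArg (s * ·) b₁
  replace d₁ := congrArg (s * ·) d₁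
  replace a₂ := congrArg (t * ·) a₂
  replace b₂ := congrArg (t * ·) b₂
  replace d₂ := congrArg (t * ·) d₂
  ring_nf at a₀ a₁ a₂ b₀ b₁ b₂ d₀ d₁ d₂
  refine ⟨?_, ?_, ?_, ?_, ?_, ?_, ?_, ?_, ?_⟩ <;>
    rw [eq_div_iff (by positivity)] <;> linarith

/-- The moment of a second derivative of an Adini basis function against an affine polynomial
separates into a function of the width and a function of the height of the rectangle. The sides
`s` and `t` are signed, so that all four rectangles of the patch are covered. -/
theorem exists_moment_eq_add (A : Fin 3 → ℝ) {p : MvPolynomial (Fin 2) ℝ}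
    (hp : p.totalDegree ≤ 1) (j k : Fin 2) :
    ∃ F G : ℝ → ℝ, ∀ (s t : ℝ) (f : MvPolynomial (Fin 2) ℝ), s ≠ 0 → t ≠ 0 → f ∈ AdiniSpace →
      (∀ β, adiniDof β (0, 0) f = A β) →
      (∀ β, adiniDof β (s, 0) f = 0 ∧ adiniDof β (s, t) f = 0 ∧ adiniDof β (0, t) f = 0) →
      ∫ x in (0 : ℝ)..s, ∫ y in (0 : ℝ)..t, pev x y p * pev x y (pderiv j (pderiv k f))
        = F s + G t := by
  obtain ⟨q₀, q₁, q₂, hq⟩ := exists_pev_eq_affine hp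
  have hmixed : ∀ (s t : ℝ) (c : Fin 12 → ℝ), s ≠ 0 → t ≠ 0 →
      (∀ β, adiniDof β (0, 0) (adiniPoly c) = A β) →
      (∀ β, adiniDof β (s, 0) (adiniPoly c) = 0 ∧ adiniDof β (s, t) (adiniPoly c) = 0 ∧
        adiniDof β (0, t) (adiniPoly c) = 0) →
      ∫ x in (0 : ℝ)..s, ∫ y in (0 : ℝ)..t, (q₀ + q₁ * x + q₂ * y)
          * (c 4 + 2 * c 7 * x + 2 * c 8 * y + 3 * c 10 * x ^ 2 + 3 * c 11 * y ^ 2)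
        = (q₀ * A 0 + q₁ * (s * A 0 / 2 + s ^ 2 * A 1 / 12))
          + q₂ * (t * A 0 / 2 + t ^ 2 * A 2 / 12) := by
    intro s t c hs ht h₀ h
    obtain ⟨-, h4, -, -, h7, h8, -, h10, h11⟩ := adiniPoly_coeff_eq hs ht h₀ h
    rw [iteratedIntegral_cubic s t (q₀ * c 4) (q₀ * (2 * c 7) + q₁ * c 4)
      (q₀ * (2 * c 8) + q₂ * c 4) (q₀ * (3 * c 10) + q₁ * (2 * c 7))
      (q₁ * (2 * c 8) + q₂ * (2 * c 7)) (q₀ * (3 * c 11) + q₂ * (2 * c 8))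
      (q₁ * (3 * c 10)) (q₂ * (3 * c 10)) (q₁ * (3 * c 11)) (q₂ * (3 * c 11))
      (fun x y => by ring), h4, h7, h8, h10, h11]
    field_simp
    ring
  fin_cases j <;> fin_cases k
  · refine ⟨fun _ => 0, fun t => q₁ * (t * A 0 / 2) - A 1 * (q₀ * t / 2 + q₂ * t ^ 2 / 6), ?_⟩
    intro s t f hs ht hf h₀ h
    obtain ⟨c, rfl⟩ := exists_eq_adiniPoly hf
    obtain ⟨h3, -, -, h6, h7, -, -, h10, -⟩ := adiniPoly_coeff_eq hs ht h₀ h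
    simp only [Fin.zero_eta, hq, pev_pderiv_zero_zero_adiniPoly]
    rw [iteratedIntegral_cubic s t (q₀ * (2 * c 3)) (q₀ * (6 * c 6) + q₁ * (2 * c 3))
      (q₀ * (2 * c 7) + q₂ * (2 * c 3)) (q₁ * (6 * c 6))
      (q₀ * (6 * c 10) + q₁ * (2 * c 7) + q₂ * (6 * c 6)) (q₂ * (2 * c 7)) 0
      (q₁ * (6 * c 10)) (q₂ * (6 * c 10)) 0 (fun x y => by ring), h3, h6, h7, h10]
    field_simp
    ring
  · refine ⟨fun s => q₀ * A 0 + q₁ * (s * A 0 / 2 + s ^ 2 * A 1 / 12),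
      fun t => q₂ * (t * A 0 / 2 + t ^ 2 * A 2 / 12), ?_⟩
    intro s t f hs ht hf h₀ h
    obtain ⟨c, rfl⟩ := exists_eq_adiniPoly hf
    simp only [Fin.zero_eta, Fin.mk_one, hq, pev_pderiv_zero_one_adiniPoly]
    exact hmixed s t c hs ht h₀ h
  · refine ⟨fun s => q₀ * A 0 + q₁ * (s * A 0 / 2 + s ^ 2 * A 1 / 12),
      fun t => q₂ * (t * A 0 / 2 + t ^ 2 * A 2 / 12), ?_⟩
    intro s t f hs ht hf h₀ h
    obtain ⟨c, rfl⟩ := exists_eq_adiniPoly hf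
    simp only [Fin.zero_eta, Fin.mk_one, hq, pev_pderiv_one_zero_adiniPoly]
    exact hmixed s t c hs ht h₀ h
  · refine ⟨fun s => q₂ * (s * A 0 / 2) - A 2 * (q₀ * s / 2 + q₁ * s ^ 2 / 6), fun _ => 0, ?_⟩
    intro s t f hs ht hf h₀ h
    obtain ⟨c, rfl⟩ := exists_eq_adiniPoly hf
    obtain ⟨-, -, h5, -, -, h8, h9, -, h11⟩ := adiniPoly_coeff_eq hs ht h₀ h
    simp only [Fin.mk_one, hq, pev_pderiv_one_one_adiniPoly]
    rw [iteratedIntegral_cubic s t (q₀ * (2 * c 5)) (q₀ * (2 * c 8) + q₁ * (2 * c 5))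
      (q₀ * (6 * c 9) + q₂ * (2 * c 5)) (q₁ * (2 * c 8))
      (q₀ * (6 * c 11) + q₂ * (2 * c 8) + q₁ * (6 * c 9)) (q₂ * (6 * c 9)) 0
      (q₁ * (6 * c 11)) (q₂ * (6 * c 11)) 0 (fun x y => by ring), h5, h8, h9, h11]
    field_simp
    ring

/-- **Lemma l:d2orthp1.** Let the four rectangles `T₁ = [0,a]×[0,c]`,
`T₂ = [−b,0]×[0,c]`, `T₃ = [−b,0]×[−d,0]`, `T₄ = [0,a]×[−d,0]` form the patch
around the origin, and for each `i` let `φᵢ ∈ 𝒜` be the Adini basis function on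
`Tᵢ` of the degree of freedom `α` at the origin. Then for every affine `p` and
every second derivative `∂²_{jk}`, `Σᵢ ∫_{Tᵢ} p ∂²_{jk}φᵢ = 0`. -/
theorem adini_patch_orth_affine (a b c d : ℝ)
    (ha : 0 < a) (hb : 0 < b) (hc : 0 < c) (hd : 0 < d)
    (α : Fin 3) (φ : Fin 4 → MvPolynomial (Fin 2) ℝ)
    (hφA : ∀ i, φ i ∈ AdiniSpace)
    (hdof0 : ∀ (i : Fin 4) (β : Fin 3),
      adiniDof β (0, 0) (φ i) = if β = α then 1 else 0)
    (hv1 : ∀ β : Fin 3, adiniDof β (a, 0) (φ 0) = 0 ∧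
      adiniDof β (a, c) (φ 0) = 0 ∧ adiniDof β (0, c) (φ 0) = 0)
    (hv2 : ∀ β : Fin 3, adiniDof β (-b, 0) (φ 1) = 0 ∧
      adiniDof β (-b, c) (φ 1) = 0 ∧ adiniDof β (0, c) (φ 1) = 0)
    (hv3 : ∀ β : Fin 3, adiniDof β (-b, 0) (φ 2) = 0 ∧
      adiniDof β (-b, -d) (φ 2) = 0 ∧ adiniDof β (0, -d) (φ 2) = 0)
    (hv4 : ∀ β : Fin 3, adiniDof β (a, 0) (φ 3) = 0 ∧
      adiniDof β (a, -d) (φ 3) = 0 ∧ adiniDof β (0, -d) (φ 3) = 0)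
    (p : MvPolynomial (Fin 2) ℝ) (hp : p.totalDegree ≤ 1)
    (j k : Fin 2) :
    (∫ x in (0 : ℝ)..a, ∫ y in (0 : ℝ)..c,
        pev x y p * pev x y (pderiv j (pderiv k (φ 0))))
      + (∫ x in (-b : ℝ)..0, ∫ y in (0 : ℝ)..c,
          pev x y p * pev x y (pderiv j (pderiv k (φ 1))))
      + (∫ x in (-b : ℝ)..0, ∫ y in (-d : ℝ)..0,
          pev x y p * pev x y (pderiv j (pderiv k (φ 2))))
      + (∫ x in (0 : ℝ)..a, ∫ y in (-d : ℝ)..0,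
          pev x y p * pev x y (pderiv j (pderiv k (φ 3)))) = 0 := by
  obtain ⟨F, G, hFG⟩ := exists_moment_eq_add (fun β => if β = α then 1 else 0) hp j k
  have hb' : -b ≠ 0 := neg_ne_zero.mpr hb.ne'
  have hd' : -d ≠ 0 := neg_ne_zero.mpr hd.ne'
  have h₁ := hFG a c (φ 0) ha.ne' hc.ne' (hφA 0) (hdof0 0) hv1
  have h₂ := hFG (-b) c (φ 1) hb' hc.ne' (hφA 1) (hdof0 1) hv2
  have h₃ := hFG (-b) (-d) (φ 2) hb' hd' (hφA 2) (hdof0 2) hv3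
  have h₄ := hFG a (-d) (φ 3) ha.ne' hd' (hφA 3) (hdof0 3) hv4
  simp only [intervalIntegral.integral_symm 0 (-b), intervalIntegral.integral_symm 0 (-d),
    intervalIntegral.integral_neg, h₁, h₂, h₃, h₄]
  ring
end
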